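/- Let k be a positive integer and let b, η be real constants with 0 < b < 1/(2k) and 0 < η ≤ (1 + 18(k−1)!/b)^{-2}. There exists n₀ = n₀(k,b,η) such that for all integers n ≥ n₀ and m with b·n ≤ m ≤ n/(2k) the following holds: if H is a stable k-graph on vertex set [n] with e(H) > C(n,k) − C(n−m,k) − η·n^k, and H is not √η-close to H_k(m,n), then ν(H) > m. -/

import Mathlib

/-- `H_k(m,n)`: the `k`-graph on `Fin n` whose edges are the `k`-subsets meeting `[m]`. -/
def Hk (n k m : ℕ) : Finset (Finset (Fin n)) :=
  (Finset.univ.powersetCard k).filter fun e => ∃ v ∈ e, (v : ℕ) < m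

section Auxiliary

open Finset

/-- Two ordered pairs of disjoint finite sets with matching sizes are related by a permutation. -/
lemma exists_perm_image_eq {β : Type*} [Fintype β] [DecidableEq β] {A A' B B' : Finset β}
    (hA : Disjoint A A') (hB : Disjoint B B') (h : #A = #B) (h' : #A' = #B') :
    ∃ τ : Equiv.Perm β, A.image τ = B ∧ A'.image τ = B' := by
  let f : Finset β → Finset β → β → Fin 3 := fun A A' x => if x ∈ A then 0 else if x ∈ A' then 1 else 2
  have f0 : ∀ (A A' : Finset β) x, f A A' x = 0 ↔ x ∈ A := by
    intro A A' x; simp only [f]; split_ifs <;> simp_all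
  have f1 : ∀ {A A' : Finset β}, Disjoint A A' → ∀ x, f A A' x = 1 ↔ x ∈ A' := by
    intro A A' hd x
    have : x ∈ A → x ∉ A' := fun hx => Finset.disjoint_left.1 hd hx
    simp only [f]; split_ifs <;> simp_all
  have f2 : ∀ (A A' : Finset β) x, f A A' x = 2 ↔ x ∈ (A ∪ A')ᶜ := by
    intro A A' x; simp only [f]; split_ifs <;> simp_all
  have key : ∀ c : Fin 3, Fintype.card {x // f A A' x = c} = Fintype.card {x // f B B' x = c} := by
    intro c
    rw [Fintype.card_subtype, Fintype.card_subtype]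
    fin_cases c
    · simp [f0, h]
    · simp [f1 hA, f1 hB, h']
    · have e : ∀ A A' : Finset β, univ.filter (fun x => f A A' x = 2) = (A ∪ A')ᶜ := by
        intro A A'; ext x; simp [f2]
      change #(univ.filter fun x => f A A' x = 2) = #(univ.filter fun x => f B B' x = 2)
      rw [e, e, card_compl, card_compl, card_union_of_disjoint hA, card_union_of_disjoint hB, h, h']
  let E : ∀ c, {x // f A A' x = c} ≃ {x // f B B' x = c} := fun c => Fintype.equivOfCardEq (key c)
  let τ := Equiv.ofFiberEquiv E
  have hτ : ∀ x, f B B' (τ x) = f A A' x := fun x => Equiv.ofFiberEquiv_map E x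
  refine ⟨τ, Finset.eq_of_subset_of_card_le ?_ ?_, Finset.eq_of_subset_of_card_le ?_ ?_⟩
  · rw [Finset.image_subset_iff]
    intro x hx
    rw [← f0 B B', hτ, f0]; exact hx
  · rw [card_image_of_injective _ τ.injective, h]
  · rw [Finset.image_subset_iff]
    intro x hx
    rw [← f1 hB, hτ, f1 hA]; exact hx
  · rw [card_image_of_injective _ τ.injective, h']

/-- The number of permutations carrying a pair of disjoint sets to another one. -/
lemma card_perm_image_eq {β : Type*} [Fintype β] [DecidableEq β] {A A' B B' : Finset β}
    (hA : Disjoint A A') (hB : Disjoint B B') (h : #B = #A) (h' : #B' = #A') :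
    #{σ : Equiv.Perm β | B.image σ = A ∧ B'.image σ = A'} *
      ((Fintype.card β).choose #A * (Fintype.card β - #A).choose #A') =
      (Fintype.card β).factorial := by
  classical
  let D : Finset (Σ _ : Finset β, Finset β) :=
    (univ.powersetCard #A).sigma fun C => Cᶜ.powersetCard #A'
  have hD : #D = (Fintype.card β).choose #A * (Fintype.card β - #A).choose #A' := by
    rw [card_sigma, Finset.sum_congr rfl (g := fun _ => (Fintype.card β - #A).choose #A')]
    · simp
    · intro C hC
      rw [card_powersetCard, card_compl, (mem_powersetCard.1 hC).2]
  have hmaps : ∀ σ ∈ (univ : Finset (Equiv.Perm β)),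
      (⟨B.image σ, B'.image σ⟩ : Σ _ : Finset β, Finset β) ∈ D := by
    intro σ _
    simp only [D, mem_sigma, mem_powersetCard, subset_univ, true_and,
      card_image_of_injective _ σ.injective, h, h', and_true]
    rw [subset_compl_iff_disjoint_left, disjoint_image σ.injective]
    exact hB
  have hsum := card_eq_sum_card_fiberwise hmaps
  rw [card_univ, Fintype.card_perm] at hsum
  rw [hsum, ← hD, mul_comm, ← smul_eq_mul, ← sum_const]
  refine sum_congr rfl fun P hP => ?_
  obtain ⟨P1, P2⟩ := P
  simp only [D, mem_sigma, mem_powersetCard, subset_univ, true_and] at hP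
  obtain ⟨τ, h1, h2⟩ := exists_perm_image_eq (A := A) (A' := A') (B := P1) (B' := P2) hA
    (subset_compl_iff_disjoint_left.1 hP.2.1) hP.1.symm hP.2.2.symm
  refine card_bij' (fun σ _ => τ * σ) (fun σ _ => τ⁻¹ * σ) ?_ ?_ ?_ ?_
  · intro σ hσ
    simp only [mem_filter, mem_univ, true_and, Sigma.mk.injEq, heq_eq_eq] at hσ ⊢
    rw [Equiv.Perm.coe_mul, ← image_image, ← image_image, hσ.1, hσ.2]
    exact ⟨h1, h2⟩
  · intro σ hσ
    simp only [mem_filter, mem_univ, true_and, Sigma.mk.injEq, heq_eq_eq] at hσ ⊢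
    rw [Equiv.Perm.coe_mul, ← image_image, ← image_image, hσ.1, hσ.2, ← h1, ← h2, image_image,
      image_image, ← Equiv.Perm.coe_mul]
    simp
  · intro σ _; simp
  · intro σ _; simp

/-- The number of permutations carrying a set into a given uniform family. -/
lemma card_perm_image_mem {β : Type*} [Fintype β] [DecidableEq β] {l : ℕ}
    {F : Finset (Finset β)} (hF : ∀ A ∈ F, #A = l) {B : Finset β} (hB : #B = l) :
    #{σ : Equiv.Perm β | B.image σ ∈ F} * (Fintype.card β).choose l =
      #F * (Fintype.card β).factorial := by
  have hsum := card_eq_sum_card_fiberwise (s := univ.filter fun σ : Equiv.Perm β => B.image σ ∈ F)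
    (t := F) (f := fun σ : Equiv.Perm β => B.image σ) (by intro σ hσ; simpa using hσ)
  rw [hsum, sum_mul, ← smul_eq_mul (#F), ← sum_const]
  refine sum_congr rfl fun A hA => ?_
  have := card_perm_image_eq (disjoint_empty_right A) (disjoint_empty_right B)
    (hB.trans (hF A hA).symm) rfl
  simp only [card_empty, Nat.choose_zero_right, mul_one, hF A hA, image_empty, and_true] at this
  rw [← this, filter_filter]
  congr 2
  ext σ
  simp only [mem_filter, mem_univ, true_and, and_iff_right_iff_imp]
  rintro rfl; exact hA

/-- Upper bound for the number of permutations carrying two disjoint sets into two given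
families. -/
lemma card_perm_image_mem_and_le {β : Type*} [Fintype β] [DecidableEq β] {l : ℕ}
    {F F' : Finset (Finset β)} (hF : ∀ A ∈ F, #A = l) (hF' : ∀ A ∈ F', #A = l)
    {B B' : Finset β} (hB : #B = l) (hB' : #B' = l) (hd : Disjoint B B') :
    #{σ : Equiv.Perm β | B.image σ ∈ F ∧ B'.image σ ∈ F'} *
      ((Fintype.card β).choose l * (Fintype.card β - l).choose l) ≤
      #F * #F' * (Fintype.card β).factorial := by
  have hsum := card_eq_sum_card_fiberwise
    (s := univ.filter fun σ : Equiv.Perm β => B.image σ ∈ F ∧ B'.image σ ∈ F')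
    (t := F ×ˢ F') (f := fun σ : Equiv.Perm β => (B.image σ, B'.image σ)) (by intro σ hσ; simpa using hσ)
  rw [hsum, sum_mul, ← card_product, ← smul_eq_mul (#(F ×ˢ F')), ← sum_const]
  refine sum_le_sum fun P hP => ?_
  obtain ⟨A, A'⟩ := P
  obtain ⟨hA, hA'⟩ := mem_product.1 hP
  simp only at hA hA'
  by_cases hdA : Disjoint A A'
  · have := card_perm_image_eq hdA hd (hB.trans (hF A hA).symm) (hB'.trans (hF' A' hA').symm)
    rw [hF A hA, hF' A' hA'] at this
    rw [← this]
    refine Nat.mul_le_mul_right _ (card_le_card ?_)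
    intro σ
    simp
  · rw [card_eq_zero.2, zero_mul]
    · exact Nat.zero_le _
    · rw [filter_eq_empty_iff]
      intro σ _ h
      simp only [Prod.mk.injEq] at h
      apply hdA
      rw [← h.1, ← h.2, disjoint_image σ.injective]
      exact hd

/-- A sequence of finite sets whose sizes exceed `s, s - 1, …, 0` has a system of distinct
representatives. -/
lemma exists_injective_of_lt_card {ι : Type*} [DecidableEq ι] {s : ℕ}
    {D : ℕ → Finset ι} (hc : ∀ p ≤ s, s - p < #(D p)) :
    ∃ f : Fin (s + 1) → ι, Function.Injective f ∧ ∀ i : Fin (s + 1), f i ∈ D i := by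
  refine (all_card_le_biUnion_card_iff_exists_injective fun i : Fin (s + 1) => D i).1 fun S => ?_
  rcases S.eq_empty_or_nonempty with rfl | hS
  · simp
  · have hp := Nat.lt_succ_iff.1 (S.min' hS).2
    calc #S ≤ #(Ici (S.min' hS)) := card_le_card fun i hi => mem_Ici.2 (S.min'_le i hi)
      _ = s + 1 - (S.min' hS : ℕ) := by simp
      _ ≤ #(D (S.min' hS)) := by have := hc _ hp; omega
      _ ≤ #(S.biUnion fun i : Fin (s + 1) => D i) :=
        card_le_card (subset_biUnion_of_mem (fun i : Fin (s + 1) => D i) (S.min'_mem hS))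

lemma sum_range_le_of_antitone {s t p : ℕ} {d : ℕ → ℕ} (hd : ∀ i j, i ≤ j → j ≤ s → d j ≤ d i)
    (ht : ∀ i, d i ≤ t) (hp : p ≤ s) (hdp : d p ≤ s - p) :
    (∑ i ∈ range s, (d i : ℝ)) ≤ p * t + ((s : ℝ) - p) * (s - p) := by
  rw [range_eq_Ico, ← sum_Ico_consecutive _ (Nat.zero_le p) hp]
  have h1 : ∑ i ∈ Ico 0 p, (d i : ℝ) ≤ #(Ico 0 p) • (t : ℝ) :=
    sum_le_card_nsmul _ _ _ fun i _ => by exact_mod_cast ht i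
  have h2 : ∑ i ∈ Ico p s, (d i : ℝ) ≤ #(Ico p s) • ((s : ℝ) - p) :=
    sum_le_card_nsmul _ _ _ fun i hi => by
      rw [mem_Ico] at hi
      rw [← Nat.cast_sub hp]
      exact_mod_cast (hd p i hi.1 hi.2.le).trans hdp
  rw [nsmul_eq_mul, Nat.card_Ico, Nat.sub_zero] at h1
  rw [nsmul_eq_mul, Nat.card_Ico, Nat.cast_sub hp] at h2
  linarith

lemma sum_add_mul_le_of_antitone {s t p : ℕ} {d : ℕ → ℕ}
    (hd : ∀ i j, i ≤ j → j ≤ s → d j ≤ d i) (ht : ∀ i, d i ≤ t) (hst : s ≤ t) (hp : p ≤ s)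
    (hdp : d p ≤ s - p) :
    (∑ i ∈ range s, (d i : ℝ)) + ((t : ℝ) - s) * d s ≤ s * t := by
  have h := sum_range_le_of_antitone hd ht hp hdp
  have h1 : (d s : ℝ) ≤ s - p := by
    rw [← Nat.cast_sub hp]; exact_mod_cast (hd p s hp le_rfl).trans hdp
  have h2 : (s : ℝ) ≤ t := by exact_mod_cast hst
  have h3 : (p : ℝ) ≤ s := by exact_mod_cast hp
  have h4 : (0 : ℝ) ≤ p := Nat.cast_nonneg p
  nlinarith [mul_le_mul_of_nonneg_left h1 (sub_nonneg.2 h2), mul_nonneg h4 (sub_nonneg.2 h3)]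

lemma sum_add_mul_le_of_antitone_add {s t p : ℕ} {d : ℕ → ℕ}
    (hd : ∀ i j, i ≤ j → j ≤ s → d j ≤ d i) (ht : ∀ i, d i ≤ t) (hst : 2 * s + 1 ≤ t)
    (hp : p ≤ s) (hdp : d p ≤ s - p) :
    t * (∑ i ∈ range s, (d i : ℝ)) + t * (s + 1 + s / 2) * d s ≤
      s * t * t + s * (d s * (t - d (s / 2))) := by
  have h1 : (d s : ℝ) ≤ s - p := by
    rw [← Nat.cast_sub hp]; exact_mod_cast (hd p s hp le_rfl).trans hdp
  have h2 : (2 : ℝ) * s + 1 ≤ t := by exact_mod_cast hst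
  have h3 : (p : ℝ) ≤ s := by exact_mod_cast hp
  have h0 : (0 : ℝ) ≤ d s := Nat.cast_nonneg _
  have hs0 : (0 : ℝ) ≤ s := Nat.cast_nonneg _
  have ht0 : (0 : ℝ) ≤ t := Nat.cast_nonneg _
  rcases le_or_gt p (s / 2) with hps | hps
  · have h := sum_add_mul_le_of_antitone hd ht (by omega) hp hdp
    have h5 : (d (s / 2) : ℝ) ≤ s := by
      exact_mod_cast (hd p (s / 2) hps (Nat.div_le_self _ _)).trans (hdp.trans (Nat.sub_le _ _))
    have h6 : (t : ℝ) / 2 ≤ t - d (s / 2) := by linarith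
    have h7 : (s : ℝ) * (d s * (t / 2)) ≤ s * (d s * (t - d (s / 2))) := by gcongr
    have h8 := mul_le_mul_of_nonneg_left h ht0
    have h9 : (t : ℝ) * ((2 * s + 1) * d s) ≤ t * (t * d s) := by gcongr
    nlinarith
  · have h := sum_range_le_of_antitone hd ht hp hdp
    have h4 : (s : ℝ) ≤ 2 * p := by
      have : s ≤ 2 * p := by omega
      exact_mod_cast this
    have h5 : (d (s / 2) : ℝ) ≤ t := by exact_mod_cast ht _
    have h6 : 0 ≤ (s : ℝ) * (d s * (t - d (s / 2))) :=
      mul_nonneg hs0 (mul_nonneg h0 (by linarith))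
    have h7 : ((s : ℝ) + 1 + s / 2) * d s ≤ (t - (s - p)) * (s - p) :=
      mul_le_mul (by linarith) h1 h0 (by linarith)
    have h8 : (∑ i ∈ range s, (d i : ℝ)) + (s + 1 + s / 2) * d s ≤ s * t := by nlinarith
    have h9 := mul_le_mul_of_nonneg_left h8 ht0
    nlinarith

/-- `t` disjoint blocks of size `l` in `Fin N`. -/
lemma exists_disjoint_blocks {N t l : ℕ} (h : t * l ≤ N) :
    ∃ B : Fin t → Finset (Fin N), (∀ j, #(B j) = l) ∧ ∀ i j, i ≠ j → Disjoint (B i) (B j) := by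
  let f : Fin t × Fin l ↪ Fin N := finProdFinEquiv.toEmbedding.trans (Fin.castLEEmb h)
  refine ⟨fun j => univ.map ((Function.Embedding.sectR j (Fin l)).trans f), fun j => by simp,
    fun i j hij => ?_⟩
  rw [disjoint_left]
  simp only [mem_map, mem_univ, true_and, Function.Embedding.trans_apply,
    Function.Embedding.sectR_apply, forall_exists_index]
  rintro x a ha ⟨b, hb⟩
  have := f.injective (ha.trans hb.symm)
  exact hij (congrArg Prod.fst this)

section CrossDependent

variable {N s t l : ℕ} {F : ℕ → Finset (Finset (Fin N))}

lemma sum_card_filter_image_mem {F : Finset (Finset (Fin N))} (hF : ∀ A ∈ F, #A = l)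
    {B : Fin t → Finset (Fin N)} (hB : ∀ j, #(B j) = l) :
    (∑ σ : Equiv.Perm (Fin N), (#{j | (B j).image σ ∈ F} : ℝ)) * N.choose l =
      t * #F * N.factorial := by
  have : ∑ σ : Equiv.Perm (Fin N), #{j | (B j).image σ ∈ F} =
      ∑ j, #{σ : Equiv.Perm (Fin N) | (B j).image σ ∈ F} := by
    simp only [card_filter]
    exact sum_comm
  rw [← Nat.cast_sum, this]
  have h : ∀ j, #{σ : Equiv.Perm (Fin N) | (B j).image σ ∈ F} * N.choose l =
      #F * N.factorial := fun j => by
    simpa using card_perm_image_mem hF (hB j)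
  rw [← Nat.cast_mul, sum_mul, sum_congr rfl fun j _ => h j]
  simp [mul_assoc]

lemma sum_card_mul_sub_card_le {F G : Finset (Finset (Fin N))} (hF : ∀ A ∈ F, #A = l)
    (hFG : F ⊆ G) {B : Fin t → Finset (Fin N)} (hB : ∀ j, #(B j) = l)
    (hd : ∀ i j, i ≠ j → Disjoint (B i) (B j)) :
    (∑ σ : Equiv.Perm (Fin N), (#{j | (B j).image σ ∈ F} : ℝ) *
      (t - #{j | (B j).image σ ∈ G})) * (N.choose l * (N - l).choose l) ≤
      t * t * (#F * #(univ.powersetCard l \ G)) * N.factorial := by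
  set G' := univ.powersetCard l \ G
  have h1 : ∀ σ : Equiv.Perm (Fin N), (#{j | (B j).image σ ∈ F} : ℝ) *
      (t - #{j | (B j).image σ ∈ G}) =
      ((∑ i, ∑ j, if (B i).image σ ∈ F ∧ (B j).image σ ∈ G' then 1 else 0 : ℕ) : ℝ) := by
    intro σ
    have : #{j | (B j).image σ ∈ G} + #{j | (B j).image σ ∈ G'} = t := by
      have := card_filter_add_card_filter_not (s := univ) fun j => (B j).image σ ∈ G
      rw [card_univ, Fintype.card_fin] at this
      convert this using 4
      simp [G', mem_powersetCard, card_image_of_injective _ σ.injective, hB]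
    have h2 : (t : ℝ) - #{j | (B j).image σ ∈ G} = #{j | (B j).image σ ∈ G'} := by
      rw [sub_eq_iff_eq_add']; exact_mod_cast this.symm
    rw [h2, ← Nat.cast_mul]
    congr 1
    rw [card_filter, card_filter, sum_mul_sum]
    simp only [ite_and, mul_ite, mul_one, mul_zero]
    refine sum_congr rfl fun i _ => sum_congr rfl fun j _ => ?_
    split_ifs <;> rfl
  rw [sum_congr rfl fun σ _ => h1 σ, ← Nat.cast_sum]
  have h2 : (∑ σ : Equiv.Perm (Fin N), ∑ i, ∑ j,
      if (B i).image σ ∈ F ∧ (B j).image σ ∈ G' then 1 else 0) =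
      ∑ i, ∑ j, #{σ : Equiv.Perm (Fin N) | (B i).image σ ∈ F ∧ (B j).image σ ∈ G'} := by
    rw [sum_comm]
    refine sum_congr rfl fun i _ => ?_
    rw [sum_comm]
    simp only [card_filter]
  have h3 : ∀ i j, #{σ : Equiv.Perm (Fin N) | (B i).image σ ∈ F ∧ (B j).image σ ∈ G'} *
      (N.choose l * (N - l).choose l) ≤ #F * #G' * N.factorial := by
    intro i j
    by_cases hij : i = j
    · subst hij
      rw [card_eq_zero.2, zero_mul]
      · exact Nat.zero_le _
      · rw [filter_eq_empty_iff]
        rintro σ _ ⟨h, h'⟩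
        exact (mem_sdiff.1 h').2 (hFG h)
    · have hG' : ∀ A ∈ G', #A = l := fun A hA => (mem_powersetCard.1 (mem_sdiff.1 hA).1).2
      simpa using card_perm_image_mem_and_le hF hG' (hB i) (hB j) (hd i j hij)
  rw [h2]
  have h4 : (∑ i, ∑ j, #{σ : Equiv.Perm (Fin N) | (B i).image σ ∈ F ∧ (B j).image σ ∈ G'}) *
      (N.choose l * (N - l).choose l) ≤ t * t * (#F * #G') * N.factorial := by
    simp only [sum_mul]
    calc _ ≤ ∑ _i : Fin t, ∑ _j : Fin t, #F * #G' * N.factorial :=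
          sum_le_sum fun i _ => sum_le_sum fun j _ => h3 i j
      _ = _ := by simp; ring
  exact_mod_cast h4

/-- For each permutation of the ground set, the traces of a cross-dependent sequence of
families on the permuted blocks violate the condition for distinct representatives. -/
lemma exists_card_filter_le
    (hcross : ¬ ∃ g : Fin (s + 1) → Finset (Fin N),
      (∀ i : Fin (s + 1), g i ∈ F i) ∧ ∀ i j, i ≠ j → Disjoint (g i) (g j))
    {B : Fin t → Finset (Fin N)} (hd : ∀ i j, i ≠ j → Disjoint (B i) (B j))
    (σ : Equiv.Perm (Fin N)) :
    ∃ p ≤ s, #{j | (B j).image σ ∈ F p} ≤ s - p := by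
  by_contra! hc
  obtain ⟨f, hf, hfD⟩ := exists_injective_of_lt_card
    (D := fun i => univ.filter fun j => (B j).image σ ∈ F i) hc
  refine hcross ⟨fun i => (B (f i)).image σ, fun i => by simpa using hfD i, fun i j hij => ?_⟩
  rw [disjoint_image σ.injective]
  exact hd _ _ (hf.ne hij)

/-- Weighted size bound for nested cross-dependent families. -/
lemma sum_card_add_mul_card_le_of_cross
    (hF : ∀ i j, i ≤ j → j ≤ s → F j ⊆ F i) (hl : ∀ i, ∀ A ∈ F i, #A = l)
    (hcross : ¬ ∃ g : Fin (s + 1) → Finset (Fin N),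
      (∀ i : Fin (s + 1), g i ∈ F i) ∧ ∀ i j, i ≠ j → Disjoint (g i) (g j))
    (htN : t * l ≤ N) (hst : 2 * s + 1 ≤ t) :
    (∑ i ∈ range s, (#(F i) : ℝ)) + ((t : ℝ) - s) * #(F s) ≤ s * N.choose l := by
  obtain ⟨B, hB, hd⟩ := exists_disjoint_blocks htN
  have key : ∀ σ : Equiv.Perm (Fin N),
      (∑ i ∈ range s, (#{j | (B j).image σ ∈ F i} : ℝ)) +
        ((t : ℝ) - s) * #{j | (B j).image σ ∈ F s} ≤ s * t := by
    intro σ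
    obtain ⟨p, hp, hdp⟩ := exists_card_filter_le hcross hd σ
    exact sum_add_mul_le_of_antitone (d := fun i => #{j | (B j).image σ ∈ F i})
      (fun i j hij hj => card_le_card (monotone_filter_right _ fun a _ ha => hF i j hij hj ha))
      (fun i => (card_le_univ _).trans (by simp)) (by omega) hp hdp
  have hsum := sum_le_sum fun σ (_ : σ ∈ (univ : Finset (Equiv.Perm (Fin N)))) => key σ
  rw [sum_add_distrib, sum_comm, ← mul_sum, sum_const, card_univ, Fintype.card_perm,
    Fintype.card_fin, nsmul_eq_mul] at hsum
  have hsum' := mul_le_mul_of_nonneg_right hsum (Nat.cast_nonneg (α := ℝ) (N.choose l))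
  rw [add_mul, sum_mul, mul_assoc, sum_card_filter_image_mem (hl s) hB,
    sum_congr rfl fun i _ => sum_card_filter_image_mem (hl i) hB, ← sum_mul, ← mul_sum] at hsum'
  have hpos : (0 : ℝ) < t * N.factorial := by
    have : 0 < t * N.factorial := Nat.mul_pos (by omega) N.factorial_pos
    exact_mod_cast this
  refine le_of_mul_le_mul_left ?_ hpos
  linarith

/-- Refined weighted size bound for nested cross-dependent families, with an error term measuring
how far the middle family is from being complete. -/
lemma sum_card_add_mul_card_le_of_cross_add
    (hF : ∀ i j, i ≤ j → j ≤ s → F j ⊆ F i) (hl : ∀ i, ∀ A ∈ F i, #A = l)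
    (hcross : ¬ ∃ g : Fin (s + 1) → Finset (Fin N),
      (∀ i : Fin (s + 1), g i ∈ F i) ∧ ∀ i j, i ≠ j → Disjoint (g i) (g j))
    (htN : t * l ≤ N) (hst : 2 * s + 1 ≤ t)
    (hpos' : 0 < (N - l).choose l) :
    (∑ i ∈ range s, (#(F i) : ℝ)) + (s + 1 + s / 2) * #(F s) ≤
      s * N.choose l +
        s * (#(F s) * #(univ.powersetCard l \ F (s / 2))) / (N - l).choose l := by
  obtain ⟨B, hB, hd⟩ := exists_disjoint_blocks htN
  have key : ∀ σ : Equiv.Perm (Fin N),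
      t * (∑ i ∈ range s, (#{j | (B j).image σ ∈ F i} : ℝ)) +
        t * (s + 1 + s / 2) * #{j | (B j).image σ ∈ F s} ≤ s * t * t +
        s * (#{j | (B j).image σ ∈ F s} * (t - #{j | (B j).image σ ∈ F (s / 2)})) := by
    intro σ
    obtain ⟨p, hp, hdp⟩ := exists_card_filter_le hcross hd σ
    exact sum_add_mul_le_of_antitone_add (d := fun i => #{j | (B j).image σ ∈ F i})
      (fun i j hij hj => card_le_card (monotone_filter_right _ fun a _ ha => hF i j hij hj ha))
      (fun i => (card_le_univ _).trans (by simp)) hst hp hdp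
  have hsum := sum_le_sum fun σ (_ : σ ∈ (univ : Finset (Equiv.Perm (Fin N)))) => key σ
  rw [sum_add_distrib, sum_add_distrib, ← mul_sum, sum_comm, ← mul_sum, sum_const, ← mul_sum,
    card_univ, Fintype.card_perm, Fintype.card_fin, nsmul_eq_mul] at hsum
  have hsum' := mul_le_mul_of_nonneg_right hsum (Nat.cast_nonneg (α := ℝ) (N.choose l))
  rw [add_mul, mul_assoc (t : ℝ), sum_mul, mul_assoc (t * _ : ℝ),
    sum_card_filter_image_mem (hl s) hB,
    sum_congr rfl fun i _ => sum_card_filter_image_mem (hl i) hB, ← sum_mul, ← mul_sum] at hsum'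
  have hpair := sum_card_mul_sub_card_le (hl s) (hF (s / 2) s (Nat.div_le_self _ _) le_rfl) hB hd
  have hC2 : (0 : ℝ) < (N - l).choose l := by exact_mod_cast hpos'
  rw [← mul_assoc, ← le_div_iff₀ hC2] at hpair
  have hpair' := mul_le_mul_of_nonneg_left hpair (Nat.cast_nonneg (α := ℝ) s)
  have hpos : (0 : ℝ) < t * t * N.factorial := by
    have : 0 < t * t * N.factorial :=
      Nat.mul_pos (Nat.mul_pos (by omega) (by omega)) N.factorial_pos
    exact_mod_cast this
  refine le_of_mul_le_mul_left ?_ hpos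
  have e : (t * t * N.factorial : ℝ) * (s * N.choose l +
        s * (#(F s) * #(univ.powersetCard l \ F (s / 2))) / (N - l).choose l) =
      t * t * N.factorial * (s * N.choose l) + s * (t * t *
        (#(F s) * #(univ.powersetCard l \ F (s / 2))) * N.factorial / (N - l).choose l) := by
    ring
  rw [e]
  linarith

end CrossDependent

/-- Stability towards small vertices, for families of `k`-subsets of `{0, …, n - 1}`: membership
passes from `e` to every `f` having at least as many elements as `e` in each initial segment. -/
def InitiallyStable (n k : ℕ) (𝓕 : Finset (Finset ℕ)) : Prop :=
  ∀ e ∈ 𝓕, ∀ f ⊆ range n, #f = k → (∀ z, #{x ∈ e | x < z} ≤ #{x ∈ f | x < z}) → f ∈ 𝓕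

/-- There are no `r` pairwise disjoint members of `𝓕`. -/
def NoDisjointMembers (r : ℕ) (𝓕 : Finset (Finset ℕ)) : Prop :=
  ¬ ∃ g : Fin r → Finset ℕ, (∀ i, g i ∈ 𝓕) ∧ ∀ i j, i ≠ j → Disjoint (g i) (g j)

lemma InitiallyStable.exists_le_card_filter {n k s : ℕ} {𝓕 : Finset (Finset ℕ)}
    (hst : InitiallyStable n k 𝓕) (hk : ∀ e ∈ 𝓕, #e = k) (hν : NoDisjointMembers (s + 1) 𝓕)
    (hn : k * (s + 1) ≤ n) {e : Finset ℕ} (he : e ∈ 𝓕) :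
    ∃ i, 1 ≤ i ∧ i ≤ k ∧ i ≤ #{x ∈ e | x + 1 < i * (s + 1)} := by
  by_contra! hc
  have hinj : ∀ j : ℕ, Function.Injective fun i : ℕ => j + i * (s + 1) := by
    intro j a b hab
    simpa using hab
  refine hν ⟨fun j => (range k).image fun i : ℕ => (j : ℕ) + i * (s + 1), fun j => ?_,
    fun i j hij => ?_⟩
  · refine hst e he _ ?_ ?_ fun z => ?_
    · rw [image_subset_iff]
      intro i hi
      rw [mem_range] at hi ⊢
      have := j.2
      nlinarith [Nat.mul_le_mul_right (s + 1) (Nat.succ_le_of_lt hi)]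
    · rw [card_image_of_injective _ (hinj j), card_range]
    · set c := #{x ∈ e | x < z}
      have hck : c ≤ k := (card_filter_le _ _).trans (hk e he).le
      calc c = #((range c).image fun i : ℕ => (j : ℕ) + i * (s + 1)) := by
            rw [card_image_of_injective _ (hinj j), card_range]
        _ ≤ _ := by
          refine card_le_card fun y hy => ?_
          obtain ⟨i, hi, rfl⟩ := mem_image.1 hy
          rw [mem_range] at hi
          refine mem_filter.2 ⟨mem_image.2 ⟨i, mem_range.2 (by omega), rfl⟩, ?_⟩
          by_contra! hz
          have h1 := hc (i + 1) (by omega) (by omega)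
          have h2 : c ≤ #{x ∈ e | x + 1 < (i + 1) * (s + 1)} := by
            refine card_le_card (monotone_filter_right _ fun x _ hx => ?_)
            have := j.2
            have h3 : (i + 1) * (s + 1) = i * (s + 1) + s + 1 := by ring
            rw [h3]
            change x < z at hx
            omega
          omega
  · rw [disjoint_left]
    intro x hx hx'
    obtain ⟨a, _, rfl⟩ := mem_image.1 hx
    obtain ⟨b, _, hb⟩ := mem_image.1 hx'
    have h := congrArg (· % (s + 1)) hb
    simp only [Nat.add_mul_mod_self_right, Nat.mod_eq_of_lt i.2, Nat.mod_eq_of_lt j.2] at h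
    exact hij (Fin.ext h.symm)

/-- A uniform family whose members are dense in some initial segment is at most `s` times as large
as its shadow. -/
lemma card_le_mul_card_shadow {k s : ℕ} {X : Finset (Finset ℕ)}
    (hk : ∀ e ∈ X, #e = k)
    (hX : ∀ e ∈ X, ∃ i, 1 ≤ i ∧ i ≤ k ∧ i ≤ #{x ∈ e | x + 1 < i * (s + 1)}) :
    #X ≤ s * #X.shadow := by
  let c : Finset ℕ → ℕ → ℕ := fun e i => #{x ∈ e | x + 1 < i * (s + 1)}
  let ι : Finset ℕ → ℕ := fun e => Nat.findGreatest (fun i => i ≤ c e i) k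
  let κ : Finset ℕ → ℕ := fun e => Nat.findGreatest (fun i => i ≤ c e i + 1) k
  have hι1 : ∀ e ∈ X, 1 ≤ ι e := fun e he => by
    obtain ⟨i, h1, h2, h3⟩ := hX e he
    exact h1.trans (Nat.le_findGreatest h2 h3)
  have hιk : ∀ e, ι e ≤ k := fun e => Nat.findGreatest_le k
  have hιc : ∀ e ∈ X, ι e ≤ c e (ι e) := fun e he => by
    obtain ⟨i, h1, h2, h3⟩ := hX e he
    exact Nat.findGreatest_spec (P := fun i => i ≤ c e i) h2 h3
  have hιlt : ∀ e, ∀ j, ι e < j → j ≤ k → c e j < j := fun e j h1 h2 =>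
    not_le.1 (Nat.findGreatest_is_greatest (P := fun i => i ≤ c e i) h1 h2)
  have hmono : ∀ e i j, i ≤ j → c e i ≤ c e j := fun e i j hij =>
    card_le_card (monotone_filter_right _ fun x _ hx =>
      lt_of_lt_of_le hx (Nat.mul_le_mul_right _ hij))
  have hιeq : ∀ e ∈ X, c e (ι e) = ι e := fun e he => by
    refine le_antisymm ?_ (hιc e he)
    rcases (hιk e).eq_or_lt with h | h
    · rw [h, ← hk e he]; exact card_filter_le _ _
    · have h1 := hιlt e (ι e + 1) (by omega) h
      have h2 := hmono e (ι e) (ι e + 1) (by omega)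
      omega
  have hce : ∀ e x j, x ∈ e → x + 1 < j * (s + 1) → c (e.erase x) j + 1 = c e j := by
    intro e x j hx hxj
    simp only [c]
    rw [filter_erase, card_erase_add_one (mem_filter.2 ⟨hx, hxj⟩)]
  have hκ : ∀ e ∈ X, ∀ x ∈ e, x + 1 < ι e * (s + 1) → κ (e.erase x) = ι e := by
    intro e he x hx hxi
    refine Nat.findGreatest_eq_iff.2 ⟨hιk e, fun _ => ?_, fun j hj hjk => ?_⟩
    · rw [hce e x _ hx hxi]; exact hιc e he
    · rw [hce e x j hx (hxi.trans_le (Nat.mul_le_mul_right _ hj.le))]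
      exact not_le.2 (hιlt e j hj hjk)
  have hlevel : ∀ i ∈ Icc 1 k, #{e ∈ X | ι e = i} ≤ s * #{g ∈ X.shadow | κ g = i} := by
    intro i hi
    rw [mem_Icc] at hi
    have h := card_mul_le_card_mul (s := {e ∈ X | ι e = i}) (t := {g ∈ X.shadow | κ g = i})
      (m := i) (n := i * s) (fun e g => ∃ x ∈ e, x + 1 < i * (s + 1) ∧ e.erase x = g) ?_ ?_
    · refine Nat.le_of_mul_le_mul_left (c := i) ?_ hi.1
      calc _ = _ := mul_comm _ _
        _ ≤ _ := h
        _ = _ := by ring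
    · intro e he₀
      obtain ⟨he, rfl⟩ := mem_filter.1 he₀
      calc ι e = #({x ∈ e | x + 1 < ι e * (s + 1)}.image fun x => e.erase x) := by
            rw [card_image_of_injOn]
            · exact (hιeq e he).symm
            · intro x hx y hy hxy
              exact (erase_inj _ (mem_filter.1 hx).1).1 hxy
        _ ≤ _ := by
          refine card_le_card fun g hg => ?_
          obtain ⟨x, hx, rfl⟩ := mem_image.1 hg
          obtain ⟨hx, hxi⟩ := mem_filter.1 hx
          refine mem_filter.2 ⟨mem_filter.2 ⟨erase_mem_shadow he hx, hκ e he x hx hxi⟩,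
            x, hx, hxi, rfl⟩
    · intro g hg
      by_cases hne : (bipartiteBelow
          (fun e g => ∃ x ∈ e, x + 1 < i * (s + 1) ∧ e.erase x = g) {e ∈ X | ι e = i} g).Nonempty
      · obtain ⟨e, he₀⟩ := hne
        obtain ⟨he₁, x, hx, hxi, rfl⟩ := mem_filter.1 he₀
        obtain ⟨he, rfl⟩ := mem_filter.1 he₁
        have h1 := hce e x _ hx hxi
        rw [hιeq e he] at h1
        set g := e.erase x
        set i := ι e
        let W := {y ∈ range (i * (s + 1) - 1) | y ∉ g}
        have hW : #W + c g i = i * (s + 1) - 1 := by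
          have := card_filter_add_card_filter_not (s := range (i * (s + 1) - 1)) fun y => y ∉ g
          rw [card_range] at this
          rw [← this]
          congr 1
          refine congrArg card ?_
          ext y
          simp only [mem_filter, not_not, mem_range, and_comm, Nat.lt_sub_iff_add_lt]
        have h2 : i * (s + 1) = i * s + i := by ring
        calc _ ≤ #(W.image fun y => insert y g) := by
              refine card_le_card fun e' he' => ?_
              obtain ⟨_, y, hy, hyi, hyg⟩ := mem_filter.1 he'
              refine mem_image.2 ⟨y, mem_filter.2 ⟨mem_range.2 (by omega), ?_⟩, ?_⟩
              · rw [← hyg]; exact notMem_erase _ _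
              · rw [← hyg, insert_erase hy]
          _ ≤ #W := card_image_le
          _ ≤ i * s := by omega
      · rw [not_nonempty_iff_eq_empty] at hne
        rw [hne, card_empty]
        exact Nat.zero_le _
  calc #X = ∑ i ∈ Icc 1 k, #{e ∈ X | ι e = i} :=
        card_eq_sum_card_fiberwise fun e he => mem_Icc.2 ⟨hι1 e he, hιk e⟩
    _ ≤ ∑ i ∈ Icc 1 k, s * #{g ∈ X.shadow | κ g = i} := sum_le_sum hlevel
    _ = s * ∑ i ∈ Icc 1 k, #{g ∈ X.shadow | κ g = i} := (mul_sum _ _ _).symm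
    _ ≤ s * #X.shadow := by
      rw [sum_card_fiberwise_eq_card_filter]
      exact Nat.mul_le_mul_left _ (card_filter_le _ _)

/-- The `k`-subsets of `{0, …, n - 1}` that meet `{0, …, m - 1}`. -/
def hittingSets (n k m : ℕ) : Finset (Finset ℕ) :=
  {e ∈ (range n).powersetCard k | ∃ v ∈ e, v < m}

lemma card_hittingSets_add {n k m : ℕ} : #(hittingSets n k m) + (n - m).choose k = n.choose k := by
  have h := card_filter_add_card_filter_not (s := (range n).powersetCard k)
    fun e => ∃ v ∈ e, v < m
  rw [card_powersetCard, card_range] at h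
  rw [← h, ← Nat.card_Ico, ← card_powersetCard, hittingSets]
  congr 2
  ext e
  simp only [mem_powersetCard, mem_filter, subset_iff, mem_Ico, mem_range, not_exists, not_and,
    not_lt]
  constructor
  · rintro ⟨h1, h2⟩
    exact ⟨⟨fun x hx => (h1 hx).2, h2⟩, fun x hx => (h1 hx).1⟩
  · rintro ⟨⟨h1, h2⟩, h3⟩
    exact ⟨fun x hx => ⟨h3 x hx, h1 hx⟩, h2⟩

section Link

variable {n l s : ℕ} {𝓕 : Finset (Finset ℕ)}

/-- The embedding of `Fin (n - (s + 1))` onto the integers in `[s + 1, n)`. -/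
def tailEmb (n s : ℕ) : Fin (n - (s + 1)) ↪ ℕ :=
  ⟨fun x => s + 1 + x, fun x y h => Fin.ext (by simpa using h)⟩

lemma tailEmb_apply (x : Fin (n - (s + 1))) : tailEmb n s x = s + 1 + x := rfl

lemma lt_of_mem_map_tailEmb {A : Finset (Fin (n - (s + 1)))} {x : ℕ}
    (hx : x ∈ A.map (tailEmb n s)) : s < x ∧ x < n := by
  obtain ⟨y, _, rfl⟩ := mem_map.1 hx
  have := y.2
  rw [tailEmb_apply]
  omega

lemma exists_map_tailEmb_eq {A : Finset ℕ} (hA : ∀ x ∈ A, s < x ∧ x < n) :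
    ∃ A' : Finset (Fin (n - (s + 1))), A'.map (tailEmb n s) = A := by
  have : A ⊆ univ.map (tailEmb n s) := fun x hx => by
    obtain ⟨h1, h2⟩ := hA x hx
    refine mem_map.2 ⟨⟨x - (s + 1), by omega⟩, mem_univ _, ?_⟩
    change s + 1 + (x - (s + 1)) = x
    omega
  obtain ⟨A', _, h⟩ := subset_map_iff.1 this
  exact ⟨A', h.symm⟩

/-- The `l`-subsets of `[s + 1, n)` which together with `i` form a member of `𝓕`. -/
def tailLink (n l s : ℕ) (𝓕 : Finset (Finset ℕ)) (i : ℕ) : Finset (Finset (Fin (n - (s + 1)))) :=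
  {A ∈ univ.powersetCard l | insert i (A.map (tailEmb n s)) ∈ 𝓕}

lemma notMem_map_tailEmb {A : Finset (Fin (n - (s + 1)))} {i : ℕ} (hi : i ≤ s) :
    i ∉ A.map (tailEmb n s) := fun h =>
  absurd (lt_of_mem_map_tailEmb h).1 (not_lt.2 hi)

lemma card_insert_map_tailEmb {A : Finset (Fin (n - (s + 1)))} {i : ℕ} (hi : i ≤ s) :
    #(insert i (A.map (tailEmb n s))) = #A + 1 := by
  rw [card_insert_of_notMem (notMem_map_tailEmb hi), card_map]

lemma insert_map_tailEmb_subset_range {A : Finset (Fin (n - (s + 1)))} {i : ℕ} (hi : i < n) :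
    insert i (A.map (tailEmb n s)) ⊆ range n :=
  insert_subset (mem_range.2 hi) fun _ hx => mem_range.2 (lt_of_mem_map_tailEmb hx).2

lemma card_filter_insert_le {A : Finset ℕ} {i j z : ℕ} (hi : i ∉ A) (hij : i ≤ j) :
    #{x ∈ insert j A | x < z} ≤ #{x ∈ insert i A | x < z} := by
  rw [filter_insert, filter_insert]
  split_ifs with h1 h2
  · rw [card_insert_of_notMem (a := i) fun h => hi (mem_filter.1 h).1]
    exact card_insert_le _ _
  · omega
  · exact card_le_card (subset_insert _ _)
  · exact le_rfl

lemma InitiallyStable.tailLink_subset (hst : InitiallyStable n (l + 1) 𝓕) (hn : s < n) {i j : ℕ}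
    (hij : i ≤ j) (hj : j ≤ s) : tailLink n l s 𝓕 j ⊆ tailLink n l s 𝓕 i := by
  intro A hA
  obtain ⟨hA, hAj⟩ := mem_filter.1 hA
  refine mem_filter.2 ⟨hA, hst _ hAj _ (insert_map_tailEmb_subset_range (by omega)) ?_ fun z => ?_⟩
  · rw [card_insert_map_tailEmb (hij.trans hj), (mem_powersetCard.1 hA).2]
  · exact card_filter_insert_le (notMem_map_tailEmb (hij.trans hj)) hij

lemma NoDisjointMembers.tailLink (hν : NoDisjointMembers (s + 1) 𝓕) :
    ¬ ∃ g : Fin (s + 1) → Finset (Fin (n - (s + 1))),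
      (∀ i : Fin (s + 1), g i ∈ tailLink n l s 𝓕 i) ∧ ∀ i j, i ≠ j → Disjoint (g i) (g j) := by
  rintro ⟨g, hg, hd⟩
  refine hν ⟨fun i => insert (i : ℕ) ((g i).map (tailEmb n s)), fun i => (mem_filter.1 (hg i)).2,
    fun i j hij => ?_⟩
  have hi := Nat.lt_succ_iff.1 i.2
  have hj := Nat.lt_succ_iff.1 j.2
  rw [disjoint_insert_left, disjoint_insert_right, mem_insert, not_or, disjoint_map]
  exact ⟨⟨fun h => hij (Fin.ext h), notMem_map_tailEmb hi⟩, notMem_map_tailEmb hj, hd i j hij⟩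

/-- A stable family without `s + 1` disjoint members has few members avoiding `{0, …, s - 1}`. -/
lemma InitiallyStable.card_sdiff_hittingSets_le (hst : InitiallyStable n (l + 1) 𝓕)
    (h𝓕 : 𝓕 ⊆ (range n).powersetCard (l + 1)) (hν : NoDisjointMembers (s + 1) 𝓕)
    (hn : (l + 1) * (s + 1) ≤ n) :
    #(𝓕 \ hittingSets n (l + 1) s) ≤ (s + 1) * #(tailLink n l s 𝓕 s) := by
  have hsn : s < n := by nlinarith
  let X := {e ∈ 𝓕 | ∀ x ∈ e, s < x}
  have hcard : ∀ e ∈ 𝓕, #e = l + 1 := fun e he => (mem_powersetCard.1 (h𝓕 he)).2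
  have hlt : ∀ e ∈ 𝓕, ∀ x ∈ e, x < n := fun e he x hx =>
    mem_range.1 ((mem_powersetCard.1 (h𝓕 he)).1 hx)
  have hmem : ∀ A : Finset ℕ, (∀ x ∈ A, s < x ∧ x < n) → #A = l → insert s A ∈ 𝓕 →
      ∃ A' ∈ tailLink n l s 𝓕 s, A'.map (tailEmb n s) = A := by
    intro A hA hAl hAs
    obtain ⟨A', rfl⟩ := exists_map_tailEmb_eq hA
    rw [card_map] at hAl
    exact ⟨A', mem_filter.2 ⟨mem_powersetCard.2 ⟨subset_univ _, hAl⟩, hAs⟩, rfl⟩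
  have hshadow : X.shadow ⊆ (tailLink n l s 𝓕 s).image fun A => A.map (tailEmb n s) := by
    intro g hg
    obtain ⟨e, he, x, hx, rfl⟩ := mem_shadow_iff.1 hg
    obtain ⟨he, hes⟩ := mem_filter.1 he
    have hl : #(e.erase x) = l := by rw [card_erase_of_mem hx, hcard e he]; rfl
    have hs : s ∉ e.erase x := fun h => lt_irrefl _ (hes s (mem_of_mem_erase h))
    refine mem_image.2 (hmem _ (fun y hy => ⟨hes y (mem_of_mem_erase hy),
      hlt e he y (mem_of_mem_erase hy)⟩) hl ?_)
    refine hst e he _ (insert_subset (mem_range.2 hsn) fun y hy =>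
      mem_range.2 (hlt e he y (mem_of_mem_erase hy))) ?_ fun z => ?_
    · rw [card_insert_of_notMem hs, hl]
    · conv_lhs => rw [← insert_erase hx]
      exact card_filter_insert_le hs (hes x hx).le
  have hX : #X ≤ s * #(tailLink n l s 𝓕 s) :=
    (card_le_mul_card_shadow (k := l + 1) (fun e he => hcard e (mem_filter.1 he).1)
      fun e he => hst.exists_le_card_filter hcard hν hn (mem_filter.1 he).1).trans
      (Nat.mul_le_mul_left _ ((card_le_card hshadow).trans card_image_le))
  have hsub : 𝓕 \ hittingSets n (l + 1) s ⊆
      X ∪ (tailLink n l s 𝓕 s).image fun A => insert s (A.map (tailEmb n s)) := by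
    intro e he
    obtain ⟨he, hes⟩ := mem_sdiff.1 he
    have hge : ∀ x ∈ e, s ≤ x := fun x hx => by
      by_contra! h
      exact hes (mem_filter.2 ⟨h𝓕 he, x, hx, h⟩)
    rw [mem_union]
    by_cases hs : s ∈ e
    · right
      obtain ⟨A, hA, h⟩ := hmem (e.erase s)
        (fun y hy => ⟨lt_of_le_of_ne (hge y (mem_of_mem_erase hy)) (ne_of_mem_erase hy).symm,
          hlt e he y (mem_of_mem_erase hy)⟩)
        (by rw [card_erase_of_mem hs, hcard e he]; rfl) (by rwa [insert_erase hs])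
      exact mem_image.2 ⟨A, hA, by rw [h, insert_erase hs]⟩
    · left
      exact mem_filter.2 ⟨he, fun x hx => lt_of_le_of_ne (hge x hx) fun h => hs (h ▸ hx)⟩
  calc _ ≤ #X + #((tailLink n l s 𝓕 s).image fun A => insert s (A.map (tailEmb n s))) :=
        (card_le_card hsub).trans (card_union_le _ _)
    _ ≤ s * #(tailLink n l s 𝓕 s) + #(tailLink n l s 𝓕 s) := add_le_add hX card_image_le
    _ = _ := by ring

/-- Sets missing from the links yield hitting sets missing from the family. -/
lemma sum_card_sdiff_tailLink_le (hn : s < n) :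
    ∑ i ∈ range s, #(univ.powersetCard l \ tailLink n l s 𝓕 i) ≤
      #(hittingSets n (l + 1) s \ 𝓕) := by
  rw [← card_sigma]
  refine card_le_card_of_injOn (fun P => insert P.1 (P.2.map (tailEmb n s))) ?_ ?_
  · rintro ⟨i, A⟩ hP
    obtain ⟨hi, hA⟩ := mem_sigma.1 hP
    obtain ⟨hA, hA'⟩ := mem_sdiff.1 hA
    simp only [mem_range] at hi
    refine mem_sdiff.2 ⟨mem_filter.2 ⟨mem_powersetCard.2
      ⟨insert_map_tailEmb_subset_range (hi.trans hn), ?_⟩, i, mem_insert_self _ _, hi⟩, fun h =>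
        hA' (mem_filter.2 ⟨hA, h⟩)⟩
    rw [card_insert_map_tailEmb hi.le, (mem_powersetCard.1 hA).2]
  · rintro ⟨i, A⟩ hP ⟨j, A'⟩ hP' h
    have hi : i < s := mem_range.1 (mem_sigma.1 hP).1
    have hj : j < s := mem_range.1 (mem_sigma.1 hP').1
    simp only at h
    have hij : i = j := by
      have : i ∈ insert j (A'.map (tailEmb n s)) := h ▸ mem_insert_self _ _
      exact (mem_insert.1 this).resolve_right (notMem_map_tailEmb hi.le)
    subst hij
    have := congrArg (fun e => e.erase i) h
    simp only [erase_insert (notMem_map_tailEmb hi.le), map_inj] at this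
    rw [this]

lemma mul_choose_le_card_hittingSets (hn : s < n) :
    s * (n - (s + 1)).choose l ≤ #(hittingSets n (l + 1) s) := by
  simpa [tailLink] using sum_card_sdiff_tailLink_le (l := l) (𝓕 := ∅) hn

/-- A stable family without `s + 1` disjoint members and with almost as many members as there are
hitting sets contains almost all hitting sets. -/
lemma InitiallyStable.card_hittingSets_sdiff_le (hst : InitiallyStable n (l + 1) 𝓕)
    (h𝓕 : 𝓕 ⊆ (range n).powersetCard (l + 1)) (hν : NoDisjointMembers (s + 1) 𝓕)
    (hn : 2 * (l + 1) * s ≤ n) (hs : 4 * (l + 1) ≤ s) {L : ℝ} (hL0 : 0 ≤ L)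
    (hpos : 0 < (n - (s + 1) - l).choose l)
    (hL : 32 * (l + 1) * L ≤ s * (n - (s + 1) - l).choose l)
    (hcard : (n.choose (l + 1) : ℝ) - (n - s).choose (l + 1) - L < #𝓕) :
    (#(hittingSets n (l + 1) s \ 𝓕) : ℝ) ≤ 6 * L := by
  have hn1 : (l + 1) * (s + 1) ≤ n := by nlinarith
  have hsn : s < n := by nlinarith
  set N := n - (s + 1) with hN
  set F := tailLink n l s 𝓕
  have hF : ∀ i j, i ≤ j → j ≤ s → F j ⊆ F i := fun i j hij hj => hst.tailLink_subset hsn hij hj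
  have hl : ∀ i, ∀ A ∈ F i, #A = l := fun i A hA =>
    (mem_powersetCard.1 (mem_filter.1 hA).1).2
  have hF' : ∀ i, F i ⊆ univ.powersetCard l := fun i => filter_subset _ _
  obtain ⟨r, hr1, hr2⟩ : ∃ r, r * (2 * (l + 1)) ≤ s ∧ s ≤ (r + 1) * (2 * (l + 1)) :=
    ⟨s / (2 * (l + 1)), Nat.div_mul_le_self _ _,
      (Nat.lt_mul_of_div_lt (Nat.lt_succ_self _) (by omega)).le⟩
  have htN : (2 * s + 2 + r) * l ≤ N := by
    rw [hN]
    refine Nat.le_sub_of_add_le ?_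
    nlinarith
  have hA := sum_card_add_mul_card_le_of_cross hF hl hν.tailLink htN (by omega)
  have hB := sum_card_add_mul_card_le_of_cross_add hF hl hν.tailLink htN (by omega) hpos
  have hmiss : ∑ i ∈ range s, #(univ.powersetCard l \ F i) ≤ #(hittingSets n (l + 1) s \ 𝓕) :=
    sum_card_sdiff_tailLink_le hsn
  have hextra := hst.card_sdiff_hittingSets_le h𝓕 hν hn1
  have hsplit := card_sdiff_add_card (hittingSets n (l + 1) s) 𝓕
  have hsplit' := card_sdiff_add_card 𝓕 (hittingSets n (l + 1) s)
  have htot := card_hittingSets_add (n := n) (k := l + 1) (m := s)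
  rw [union_comm] at hsplit'
  set M := #(hittingSets n (l + 1) s \ 𝓕)
  set x := #(F s)
  set y := #(univ.powersetCard l \ F (s / 2))
  have hM : (M : ℝ) ≤ L + (s + 1) * x := by
    have h1 : (M : ℝ) + #𝓕 = #(𝓕 \ hittingSets n (l + 1) s) + #(hittingSets n (l + 1) s) := by
      exact_mod_cast hsplit.trans hsplit'.symm
    have h2 : (#(hittingSets n (l + 1) s) : ℝ) + (n - s).choose (l + 1) = n.choose (l + 1) := by
      exact_mod_cast htot
    have h3 : (#(𝓕 \ hittingSets n (l + 1) s) : ℝ) ≤ (s + 1) * x := by exact_mod_cast hextra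
    linarith
  have hsum : (s : ℝ) * N.choose l - ∑ i ∈ range s, (#(F i) : ℝ) ≤ M := by
    have h1 : ∀ i, #(univ.powersetCard l \ F i) + #(F i) = N.choose l := fun i => by
      rw [card_sdiff_add_card_eq_card (hF' i), card_powersetCard, card_univ, Fintype.card_fin]
    have h2 : ∑ i ∈ range s, #(univ.powersetCard l \ F i) + ∑ i ∈ range s, #(F i) =
        s * N.choose l := by
      rw [← sum_add_distrib, sum_congr rfl fun i _ => h1 i]; simp
    rw [sub_le_iff_le_add]
    have h3 : s * N.choose l ≤ M + ∑ i ∈ range s, #(F i) := by omega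
    exact_mod_cast h3
  have hy : (s : ℝ) / 2 * y ≤ M := by
    have h1 : #(Ico (s / 2) s) • y ≤ ∑ i ∈ Ico (s / 2) s, #(univ.powersetCard l \ F i) :=
      card_nsmul_le_sum _ _ _ fun i hi => card_le_card
        (sdiff_subset_sdiff le_rfl (hF _ _ (mem_Ico.1 hi).1 (mem_Ico.1 hi).2.le))
    have h2 : ∑ i ∈ Ico (s / 2) s, #(univ.powersetCard l \ F i) ≤
        ∑ i ∈ range s, #(univ.powersetCard l \ F i) :=
      sum_le_sum_of_subset fun i hi => mem_range.2 (mem_Ico.1 hi).2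
    rw [smul_eq_mul, Nat.card_Ico] at h1
    have h3 : s * y ≤ 2 * M := by
      have h4 : s ≤ 2 * (s - s / 2) := by omega
      calc s * y ≤ 2 * (s - s / 2) * y := Nat.mul_le_mul_right _ h4
        _ = 2 * ((s - s / 2) * y) := by ring
        _ ≤ 2 * M := by omega
    have h5 : (s : ℝ) * y ≤ 2 * M := by exact_mod_cast h3
    linarith
  have hx0 : (0 : ℝ) ≤ x := Nat.cast_nonneg _
  have hs4 : (4 : ℝ) * (l + 1) ≤ s := by exact_mod_cast hs
  have hl0 : (0 : ℝ) ≤ l := Nat.cast_nonneg _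
  have hC2 : (0 : ℝ) < (N - l).choose l := by exact_mod_cast hpos
  have hr2' : (s : ℝ) ≤ (r + 1) * (2 * (l + 1)) := by exact_mod_cast hr2
  push_cast at hA
  have hrx : ((r : ℝ) + 1) * x ≤ L := by nlinarith
  have hsx : (s : ℝ) * x ≤ 2 * (l + 1) * L := by
    calc (s : ℝ) * x ≤ (r + 1) * (2 * (l + 1)) * x := by gcongr
      _ = 2 * (l + 1) * ((r + 1) * x) := by ring
      _ ≤ 2 * (l + 1) * L := by gcongr
  have hx4 : (4 : ℝ) * x ≤ s * x := by gcongr; linarith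
  have hy4 : (y : ℝ) ≤ (N - l).choose l / 4 := by
    have hs0 : (0 : ℝ) < s := by linarith
    refine le_of_mul_le_mul_left (a := (s : ℝ)) ?_ hs0
    nlinarith
  have herr : (s : ℝ) * (x * y) / (N - l).choose l ≤ s * x / 4 := by
    rw [div_le_iff₀ hC2]
    calc (s : ℝ) * (x * y) ≤ s * (x * ((N - l).choose l / 4)) := by gcongr
      _ = _ := by ring
  have hfin : (s : ℝ) * x ≤ 4 * L := by nlinarith
  nlinarith

end Link

/-- Comparison of upper segments gives the termwise comparison of the sorted elements. -/
lemma orderIsoOfFin_le_of_card_filter_le {α : Type*} [LinearOrder α] {k : ℕ} {e f : Finset α}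
    (he : #e = k) (hf : #f = k) (h : ∀ w, #{v ∈ e | w < v} ≤ #{v ∈ f | w < v}) (i : Fin k) :
    (e.orderIsoOfFin he i : α) ≤ f.orderIsoOfFin hf i := by
  rw [coe_orderIsoOfFin_apply, coe_orderIsoOfFin_apply]
  by_contra! hlt
  have h1 : #(Ici i) ≤ #{v ∈ e | f.orderEmbOfFin hf i < v} := by
    rw [← card_image_of_injective (Ici i) (e.orderEmbOfFin he).injective]
    refine card_le_card (image_subset_iff.2 fun j hj => mem_filter.2
      ⟨orderEmbOfFin_mem _ _ _, hlt.trans_le ?_⟩)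
    exact (e.orderEmbOfFin he).monotone (mem_Ici.1 hj)
  have h2 : #{v ∈ f | f.orderEmbOfFin hf i < v} ≤ #(Ioi i) := by
    rw [← card_image_of_injective (Ioi i) (f.orderEmbOfFin hf).injective]
    refine card_le_card fun v hv => ?_
    obtain ⟨hv, hiv⟩ := mem_filter.1 hv
    obtain ⟨j, rfl⟩ : v ∈ Set.range (f.orderEmbOfFin hf) := by
      rw [range_orderEmbOfFin]; exact hv
    exact mem_image.2 ⟨j, mem_Ioi.2 ((f.orderEmbOfFin hf).lt_iff_lt.1 hiv), rfl⟩
  have h3 := h (f.orderEmbOfFin hf i)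
  rw [Fin.card_Ici] at h1
  rw [Fin.card_Ioi] at h2
  have := i.2
  omega

/-- The order-reversing embedding of `Fin n` into `ℕ` with image `{0, …, n - 1}`. -/
def revEmb (n : ℕ) : Fin n ↪ ℕ := Fin.revPerm.toEmbedding.trans Fin.valEmbedding

lemma revEmb_apply {n : ℕ} (v : Fin n) : revEmb n v = n - (v + 1) := by
  simp [revEmb]

lemma map_revEmb_subset_range {n : ℕ} (e : Finset (Fin n)) : e.map (revEmb n) ⊆ range n := by
  intro x hx
  obtain ⟨v, _, rfl⟩ := mem_map.1 hx
  exact mem_range.2 (Fin.is_lt _)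

lemma exists_map_revEmb_eq {n : ℕ} {f : Finset ℕ} (hf : f ⊆ range n) :
    ∃ f' : Finset (Fin n), f'.map (revEmb n) = f := by
  have : f ⊆ univ.map (revEmb n) := fun x hx => by
    have := mem_range.1 (hf hx)
    exact mem_map.2 ⟨⟨n - (x + 1), by omega⟩, mem_univ _, by rw [revEmb_apply]; simp only; omega⟩
  obtain ⟨f', _, h⟩ := subset_map_iff.1 this
  exact ⟨f', h.symm⟩

lemma card_filter_map_revEmb {n : ℕ} (e : Finset (Fin n)) (w : Fin n) :
    #{x ∈ e.map (revEmb n) | x < n - (w + 1)} = #{v ∈ e | w < v} := by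
  rw [filter_map, card_map]
  congr 1
  ext v
  have := v.2
  have := w.2
  simp only [mem_filter, Function.comp_apply, revEmb_apply, Fin.lt_def]
  refine and_congr_right fun _ => ?_
  omega

/-- Reversing the vertex order turns stability towards large vertices into stability towards small
ones. -/
lemma initiallyStable_image_map_revEmb {n k : ℕ} {E : Finset (Finset (Fin n))}
    (hE : ∀ e ∈ E, #e = k)
    (hst : ∀ e f : Finset (Fin n), ∀ he : #e = k, ∀ hf : #f = k,
      (∀ i : Fin k, ((e.orderIsoOfFin he i : Fin n) : ℕ) ≤ ((f.orderIsoOfFin hf i : Fin n) : ℕ)) →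
      e ∈ E → f ∈ E) :
    InitiallyStable n k (E.image fun e => e.map (revEmb n)) := by
  intro e he f hf hfk hcount
  obtain ⟨e, heE, rfl⟩ := mem_image.1 he
  obtain ⟨f, rfl⟩ := exists_map_revEmb_eq hf
  rw [card_map] at hfk
  refine mem_image_of_mem _ (hst e f (hE e heE) hfk (fun i => ?_) heE)
  refine orderIsoOfFin_le_of_card_filter_le (hE e heE) hfk (fun w => ?_) i
  rw [← card_filter_map_revEmb, ← card_filter_map_revEmb]
  exact hcount _

/-- Pairwise disjoint nonempty members of the reversed family give a matching. -/
lemma exists_matching_of_not_noDisjointMembers {n k r : ℕ} (hk : 0 < k)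
    {E : Finset (Finset (Fin n))} (hE : ∀ e ∈ E, #e = k)
    (h : ¬ NoDisjointMembers r (E.image fun e => e.map (revEmb n))) :
    ∃ M ⊆ E, (∀ e ∈ M, ∀ f ∈ M, e ≠ f → Disjoint e f) ∧ #M = r := by
  rw [NoDisjointMembers, not_not] at h
  obtain ⟨g, hg, hd⟩ := h
  choose g' hg' hgg' using fun i => mem_image.1 (hg i)
  have hd' : ∀ i j, i ≠ j → Disjoint (g' i) (g' j) := fun i j hij => by
    rw [← disjoint_map (revEmb n), hgg', hgg']; exact hd i j hij
  refine ⟨univ.image g', image_subset_iff.2 fun i _ => hg' i, ?_, ?_⟩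
  · simp only [mem_image, mem_univ, true_and, forall_exists_index, forall_apply_eq_imp_iff]
    exact fun i j hij => hd' i j fun h => hij (h ▸ rfl)
  · rw [card_image_of_injective, card_univ, Fintype.card_fin]
    intro i j hij
    by_contra hne
    have h1 := hd' i j hne
    rw [hij, disjoint_self_iff_empty] at h1
    have h2 := hE _ (hg' j)
    rw [h1, card_empty] at h2
    omega

lemma card_hittingSets_le_card_Hk {n k m : ℕ} : #(hittingSets n k m) ≤ #(Hk n k m) := by
  refine (card_le_card fun e he => ?_).trans
    (card_image_le (s := Hk n k m) (f := fun e => e.map Fin.valEmbedding))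
  obtain ⟨he, v, hv, hvm⟩ := mem_filter.1 he
  obtain ⟨he, hek⟩ := mem_powersetCard.1 he
  have hsub : e ⊆ (univ : Finset (Fin n)).map Fin.valEmbedding := fun x hx =>
    mem_map.2 ⟨⟨x, mem_range.1 (he hx)⟩, mem_univ _, rfl⟩
  obtain ⟨e', _, rfl⟩ := subset_map_iff.1 hsub
  rw [card_map] at hek
  obtain ⟨w, hw, rfl⟩ := mem_map.1 hv
  exact mem_image_of_mem _ (mem_filter.2 ⟨mem_powersetCard.2 ⟨subset_univ _, hek⟩, w, hw, hvm⟩)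

lemma card_Hk_sdiff_le {n k m : ℕ} (E : Finset (Finset (Fin n))) :
    #(Hk n k m \ E.image fun e => e.image Fin.revPerm) ≤
      #(hittingSets n k m \ E.image fun e => e.map (revEmb n)) := by
  refine card_le_card_of_injOn (fun e => e.map Fin.valEmbedding) ?_
    (map_injective Fin.valEmbedding).injOn
  intro e he
  obtain ⟨he, heE⟩ := mem_sdiff.1 he
  obtain ⟨he, v, hv, hvm⟩ := mem_filter.1 he
  refine mem_sdiff.2 ⟨mem_filter.2 ⟨mem_powersetCard.2 ⟨fun x hx => ?_, ?_⟩,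
    v, mem_map_of_mem _ hv, hvm⟩, fun h => heE ?_⟩
  · obtain ⟨y, _, rfl⟩ := mem_map.1 hx
    exact mem_range.2 y.2
  · rw [card_map]; exact (mem_powersetCard.1 he).2
  · obtain ⟨e', he', h⟩ := mem_image.1 h
    rw [revEmb, ← map_map] at h
    refine mem_image.2 ⟨e', he', ?_⟩
    have := map_injective _ h
    rw [← this, map_eq_image]
    rfl

lemma pow_div_le_choose {n m l : ℕ} (hn : 16 * (l + 1) ^ 2 ≤ n) (hm : 2 * (l + 1) * m ≤ n) :
    (n : ℝ) ^ l / (3 * l.factorial) ≤ (n - (m + 1) - l).choose l := by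
  have hk : (0 : ℝ) < (l : ℝ) + 1 := by positivity
  have h1 : (n - m - 2 * l) ^ l ≤ l.factorial * (n - (m + 1) - l).choose l := by
    rw [← Nat.descFactorial_eq_factorial_mul_choose]
    refine le_trans (Nat.pow_le_pow_left ?_ l) (Nat.pow_sub_le_descFactorial _ l)
    omega
  have hsub : m + 2 * l ≤ n := by nlinarith
  have h2 : ((n : ℝ) - m - 2 * l) ^ l ≤ l.factorial * (n - (m + 1) - l).choose l := by
    have h3 : (((n - m - 2 * l : ℕ) : ℝ)) = (n : ℝ) - m - 2 * l := by
      rw [Nat.cast_sub (by omega), Nat.cast_sub (by omega)]; push_cast; ring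
    rw [← h3]; exact_mod_cast h1
  have hn' : (16 : ℝ) * (l + 1) ^ 2 ≤ n := by exact_mod_cast hn
  have hm' : (2 : ℝ) * (l + 1) * m ≤ n := by exact_mod_cast hm
  have hn0 : (0 : ℝ) ≤ n := Nat.cast_nonneg n
  have hl0 : (0 : ℝ) ≤ l := Nat.cast_nonneg l
  set x : ℝ := 5 / (8 * (l + 1)) with hx
  have hx1 : x * (8 * (l + 1)) = 5 := div_mul_cancel₀ _ (by positivity)
  have hx0 : 0 ≤ x := by positivity
  have hx2 : x ≤ 1 := by rw [hx, div_le_one (by positivity)]; linarith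
  have h4 : (n : ℝ) * (1 + -x) ≤ n - m - 2 * l := by
    refine le_of_mul_le_mul_left (a := 8 * ((l : ℝ) + 1)) ?_ (by positivity)
    have : 8 * ((l : ℝ) + 1) * (n * (1 + -x)) = n * (8 * (l + 1)) - n * (x * (8 * (l + 1))) := by
      ring
    rw [this, hx1]
    nlinarith
  have h5 := one_add_mul_le_pow (a := -x) (by linarith) l
  have h6 : (1 : ℝ) / 3 ≤ 1 + l * -x := by nlinarith
  have h7 : (n : ℝ) ^ l * (1 / 3) ≤ l.factorial * (n - (m + 1) - l).choose l := by
    calc (n : ℝ) ^ l * (1 / 3) ≤ n ^ l * (1 + -x) ^ l := by gcongr; exact h6.trans h5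
      _ = (n * (1 + -x)) ^ l := (mul_pow _ _ _).symm
      _ ≤ ((n : ℝ) - m - 2 * l) ^ l := by
        have : 0 ≤ (n : ℝ) * (1 + -x) := mul_nonneg hn0 (by linarith)
        gcongr
      _ ≤ _ := h2
  rw [div_le_iff₀ (by positivity)]
  linarith

end Auxiliary

/-- Lemma of Lu, Yu, and Yuan (Lemma 5.2 of the paper): for `0 < b < 1/(2k)` and
`0 < η ≤ (1 + 18(k-1)!/b)⁻²`, for sufficiently large `n` and `bn ≤ m ≤ n/(2k)`: every
stable `k`-graph `H` on `[n]` with `e(H) > C(n,k) - C(n-m,k) - ηn^k` that is not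
`√η`-close to `H_k(m,n)` satisfies `ν(H) > m`. Here `e ≤ f` (for `k`-sets) means the
`i`-th smallest element of `e` is at most the `i`-th smallest element of `f` for each `i`,
and stability means `e ≤ f`, `e ∈ E(H)` imply `f ∈ E(H)`. -/
theorem stmt_17 (k : ℕ) (hk : 0 < k) (b η : ℝ)
    (hb0 : 0 < b) (hb1 : b < 1 / (2 * k))
    (hη0 : 0 < η) (hη1 : η ≤ ((1 + 18 * ((k - 1).factorial : ℝ) / b) ^ 2)⁻¹) :
    ∃ n₀ : ℕ, ∀ n : ℕ, n₀ ≤ n → ∀ m : ℕ,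
      b * n ≤ m → (m : ℝ) ≤ (n : ℝ) / (2 * k) →
      ∀ E : Finset (Finset (Fin n)), (∀ e ∈ E, e.card = k) →
        (∀ e f : Finset (Fin n), ∀ he : e.card = k, ∀ hf : f.card = k,
          (∀ i : Fin k, ((e.orderIsoOfFin he i : Fin n) : ℕ) ≤ ((f.orderIsoOfFin hf i : Fin n) : ℕ)) →
          e ∈ E → f ∈ E) →
        (Nat.choose n k : ℝ) - (Nat.choose (n - m) k : ℝ) - η * (n : ℝ) ^ k < (E.card : ℝ) →
        ¬ (∃ σ : Equiv.Perm (Fin n),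
            (((Hk n k m) \ E.image fun e => e.image σ).card : ℝ)
              ≤ Real.sqrt η * ((Hk n k m).card : ℝ)) →
        ∃ M ⊆ E, (∀ e ∈ M, ∀ f ∈ M, e ≠ f → Disjoint e f) ∧ m < M.card := by
  obtain ⟨l, rfl⟩ : ∃ l, k = l + 1 := ⟨k - 1, by omega⟩
  simp only [Nat.add_sub_cancel] at hη1
  push_cast at hb1
  have hq0 : 0 < √η := Real.sqrt_pos.2 hη0
  have hqq : √η * √η = η := Real.mul_self_sqrt hη0.le
  have hl1 : (1 : ℝ) ≤ l.factorial := by exact_mod_cast l.factorial_pos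
  have hq : 18 * l.factorial * √η ≤ b := by
    have h1 : (0 : ℝ) < 1 + 18 * l.factorial / b := by positivity
    have h2 : √η ≤ (1 + 18 * l.factorial / b)⁻¹ := by
      rw [Real.sqrt_le_left (by positivity), inv_pow]; exact hη1
    have h3 : √η * (1 + 18 * l.factorial / b) ≤ 1 := by rwa [← le_inv_mul_iff₀' h1, mul_one]
    have h4 : √η * (18 * l.factorial / b) ≤ 1 := by nlinarith
    rw [← mul_div_assoc, div_le_one hb0] at h4
    linarith
  have hbk : b * (l + 1) ≤ 1 / 2 := by
    rw [lt_div_iff₀ (by positivity)] at hb1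
    linarith
  have hqk : 32 * (l + 1) * √η ≤ 6 := by nlinarith
  refine ⟨16 * (l + 1) ^ 2 + ⌈4 * (l + 1) / b⌉₊, fun n hn m hm1 hm2 E hE hst hcard hfar => ?_⟩
  have hnk : 16 * (l + 1) ^ 2 ≤ n := by omega
  have hnb : 4 * (l + 1) / b ≤ n := Nat.ceil_le.1 (by omega)
  rw [div_le_iff₀ hb0] at hnb
  have hm4 : 4 * (l + 1) ≤ m := by
    have : (4 : ℝ) * (l + 1) ≤ m := by linarith
    exact_mod_cast this
  have hmn : 2 * (l + 1) * m ≤ n := by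
    push_cast at hm2
    rw [le_div_iff₀ (by positivity)] at hm2
    have : (2 : ℝ) * (l + 1) * m ≤ n := by linarith
    exact_mod_cast this
  have hmn' : m < n := by nlinarith
  have hn0 : (0 : ℝ) < n := by exact_mod_cast (Nat.zero_le m).trans_lt hmn'
  have hC := pow_div_le_choose hnk hmn
  have hmC : 6 * √η * n ^ (l + 1) ≤ m * (n - (m + 1) - l).choose l := by
    have h1 : 6 * √η ≤ b / (3 * l.factorial) := by
      rw [le_div_iff₀ (by positivity)]; linarith
    calc 6 * √η * n ^ (l + 1) ≤ b / (3 * l.factorial) * n ^ (l + 1) := by gcongr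
      _ = b * n * (n ^ l / (3 * l.factorial)) := by ring
      _ ≤ _ := by gcongr
  by_contra hM
  have hν : NoDisjointMembers (m + 1) (E.image fun e => e.map (revEmb n)) := by
    by_contra h
    obtain ⟨M, hME, hd, hMc⟩ := exists_matching_of_not_noDisjointMembers hk hE h
    exact hM ⟨M, hME, hd, by omega⟩
  have hE' : (E.image fun e => e.map (revEmb n)) ⊆ (Finset.range n).powersetCard (l + 1) := by
    refine Finset.image_subset_iff.2 fun e he => Finset.mem_powersetCard.2
      ⟨map_revEmb_subset_range e, ?_⟩
    rw [Finset.card_map, hE e he]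
  have hmiss := (initiallyStable_image_map_revEmb hE hst).card_hittingSets_sdiff_le hE' hν hmn hm4
    (L := η * n ^ (l + 1)) (by positivity) ?_ ?_ ?_
  · refine hfar ⟨Fin.revPerm, ?_⟩
    calc _ ≤ (((hittingSets n (l + 1) m \ E.image fun e => e.map (revEmb n)).card : ℕ) : ℝ) := by
          exact_mod_cast card_Hk_sdiff_le E
      _ ≤ 6 * (η * n ^ (l + 1)) := hmiss
      _ = √η * (6 * √η * n ^ (l + 1)) := by
        nth_rewrite 1 [← hqq]; ring
      _ ≤ √η * (m * (n - (m + 1) - l).choose l) := by gcongr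
      _ ≤ √η * (Hk n (l + 1) m).card := by
        refine mul_le_mul_of_nonneg_left ?_ hq0.le
        have h1 := mul_choose_le_card_hittingSets (l := l) hmn'
        have h2 := Nat.mul_le_mul_left m (Nat.choose_le_choose l (Nat.sub_le (n - (m + 1)) l))
        exact_mod_cast (h2.trans h1).trans card_hittingSets_le_card_Hk
  · have : (0 : ℝ) < (n - (m + 1) - l).choose l := lt_of_lt_of_le (by positivity) hC
    exact_mod_cast this
  · calc _ = 32 * (l + 1) * √η * (√η * n ^ (l + 1)) := by
          nth_rewrite 1 [← hqq]; ring
      _ ≤ 6 * (√η * n ^ (l + 1)) := by gcongr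
      _ ≤ _ := by linarith
  · rwa [Finset.card_image_of_injective _ (Finset.map_injective _)]
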